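/- arXiv:1001.0377 — 2 statements merged into one kernel-verified Lean document; each statement's English description precedes it below -/
import Mathlib

section
/- Let p > 1, q > 1, λ > 0 and α > 0 with α^p < λp*/(2q). Set k = (R^q/(2−R^q))^{1/q} and R = (q/(λp*))^{1/q}·α^{p/q}·(1/2 + (1/2)·√(1 − 2qα^p/(λp*)))^{−1/q} ∈ (0,1). Then the function u(t) = R·sn_{pq}((λp*/q)^{1/p}·(F(R)^{1/p}/R)·t, k), where F(s) = s^q − s^{2q}/2, satisfies u(0) = 0, u'(0) = α, and (φ_p(u'))' + λ·φ_q(u)·(1 − |u|^q) = 0 at every point of ℝ in the classical sense. -/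
open Real Set Filter MeasureTheory

/-- Generalized arcsine: `arcsin_{pq}(σ) = ∫_0^σ (1 - s^q)^(-1/p) ds`. -/
noncomputable def arcsinPQ (p q σ : ℝ) : ℝ :=
  ∫ s in (0:ℝ)..σ, (1 - s ^ q) ^ (-(1 / p))

/-- The generalized half-period `π_{pq} = 2 arcsin_{pq}(1)`. -/
noncomputable def piPQ (p q : ℝ) : ℝ := 2 * arcsinPQ p q 1

/-- Generalized incomplete elliptic integral:
`arcsn_{pq}(σ,k) = ∫_0^σ ((1-s^q)(1-k^q s^q))^(-1/p) ds`. -/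
noncomputable def arcsnPQ (p q k σ : ℝ) : ℝ :=
  ∫ s in (0:ℝ)..σ, ((1 - s ^ q) * (1 - k ^ q * s ^ q)) ^ (-(1 / p))

/-- Generalized complete elliptic integral `K_{pq}(k) = arcsn_{pq}(1,k)`. -/
noncomputable def Kpq (p q k : ℝ) : ℝ := arcsnPQ p q k 1

/-- `φ_m(s) = |s|^(m-2) s` for `s ≠ 0`, `φ_m(0) = 0`. -/
noncomputable def phi (m s : ℝ) : ℝ := if s = 0 then 0 else |s| ^ (m - 2) * s

/-- Incomplete beta function `B̃(a,b,u) = ∫_0^u z^(a-1) (1-z)^(b-1) dz`. -/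
noncomputable def incBeta (a b u : ℝ) : ℝ :=
  ∫ z in (0:ℝ)..u, z ^ (a - 1) * (1 - z) ^ (b - 1)

/-- A classical solution of `(φ_p(u'))' + λ φ_q(u) = 0` on `(0,T)` with
`u(0) = u(T) = 0`: `u ∈ C¹([0,T])`, `t ↦ φ_p(u'(t))` is differentiable on `(0,T)`
and the equation holds at every point of `(0,T)`. -/
def IsSolE (p q T lam : ℝ) (u : ℝ → ℝ) : Prop :=
  ∃ u' : ℝ → ℝ,
    (∀ t ∈ Set.Icc 0 T, HasDerivWithinAt u (u' t) (Set.Icc 0 T) t) ∧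
    ContinuousOn u' (Set.Icc 0 T) ∧
    (∀ t ∈ Set.Ioo 0 T, HasDerivWithinAt (fun s => phi p (u' s))
      (-(lam * phi q (u t))) (Set.Ioo 0 T) t) ∧
    u 0 = 0 ∧ u T = 0

/-- A classical solution of `(φ_p(u'))' + λ φ_q(u)(1 - |u|^q) = 0` on `(0,T)` with
`u(0) = u(T) = 0`. -/
def IsSolP (p q T lam : ℝ) (u : ℝ → ℝ) : Prop :=
  ∃ u' : ℝ → ℝ,
    (∀ t ∈ Set.Icc 0 T, HasDerivWithinAt u (u' t) (Set.Icc 0 T) t) ∧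
    ContinuousOn u' (Set.Icc 0 T) ∧
    (∀ t ∈ Set.Ioo 0 T, HasDerivWithinAt (fun s => phi p (u' s))
      (-(lam * phi q (u t) * (1 - |u t| ^ q))) (Set.Ioo 0 T) t) ∧
    u 0 = 0 ∧ u T = 0

/-- `Φ(k) = (1+k^q)^(1/p) (2k^q/(1+k^q))^(1/q - 1/p) K_{pq}(k)`. -/
noncomputable def PhiFun (p q k : ℝ) : ℝ :=
  (1 + k ^ q) ^ (1 / p) * (2 * k ^ q / (1 + k ^ q)) ^ (1 / q - 1 / p) * Kpq p q k

theorem HasDerivWithinAt.of_reflect {f : ℝ → ℝ} {c e ε : ℝ} {s t : Set ℝ}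
    (hf : ∀ x, f (2 * c - x) = ε * f x) (hε : -(ε * e) = e) (hε' : ε * ε = 1)
    (hm : MapsTo (fun x => 2 * c - x) t s) (h : HasDerivWithinAt f e s c) :
    HasDerivWithinAt f e t c := by
  have hr : HasDerivWithinAt (fun x => 2 * c - x) (-1) t c := by
    simpa using ((hasDerivAt_id c).const_sub (2 * c)).hasDerivWithinAt
  have h' : HasDerivWithinAt f e s (2 * c - c) := by
    rwa [show 2 * c - c = c by ring]
  have hcomp := (HasDerivWithinAt.comp c h' hr hm).const_mul ε
  have he : ε * (e * -1) = e := by linarith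
  have hfun : (fun y => ε * (f ∘ HSub.hSub (2 * c)) y) = f := by
    funext x
    simp only [Function.comp, hf, ← mul_assoc, hε', one_mul]
  rw [he] at hcomp
  exact hfun ▸ hcomp

theorem hasDerivAt_of_Ici_of_reflect {f : ℝ → ℝ} {c e ε : ℝ} (hf : ∀ x, f (2 * c - x) = ε * f x)
    (hε : -(ε * e) = e) (hε' : ε * ε = 1) (h : HasDerivWithinAt f e (Ici c) c) :
    HasDerivAt f e c := by
  rw [← hasDerivWithinAt_univ, ← Iic_union_Ici (a := c)]
  refine (h.of_reflect hf hε hε' fun x hx => ?_).union h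
  simp only [mem_Iic, mem_Ici] at hx ⊢
  linarith

theorem hasDerivAt_of_Iic_of_reflect {f : ℝ → ℝ} {c e ε : ℝ} (hf : ∀ x, f (2 * c - x) = ε * f x)
    (hε : -(ε * e) = e) (hε' : ε * ε = 1) (h : HasDerivWithinAt f e (Iic c) c) :
    HasDerivAt f e c := by
  rw [← hasDerivWithinAt_univ, ← Iic_union_Ici (a := c)]
  refine h.union (h.of_reflect hf hε hε' fun x hx => ?_)
  simp only [mem_Iic, mem_Ici] at hx ⊢
  linarith

theorem phi_of_nonneg {m s : ℝ} (hm : m ≠ 1) (hs : 0 ≤ s) : phi m s = s ^ (m - 1) := by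
  rcases hs.eq_or_lt with rfl | hs
  · simp [phi, Real.zero_rpow (sub_ne_zero.2 hm)]
  · rw [phi, if_neg hs.ne', abs_of_pos hs, ← Real.rpow_add_one hs.ne']
    ring_nf

theorem phi_neg (m s : ℝ) : phi m (-s) = -phi m s := by
  unfold phi
  split_ifs <;> simp_all

theorem phi_mul {a : ℝ} (ha : 0 < a) (m s : ℝ) : phi m (a * s) = a ^ (m - 1) * phi m s := by
  unfold phi
  by_cases hs : s = 0
  · simp [hs]
  · rw [if_neg hs, if_neg (by positivity), abs_mul, abs_of_pos ha,
      Real.mul_rpow ha.le (abs_nonneg s), show m - 1 = m - 2 + 1 by ring,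
      Real.rpow_add_one ha.ne']
    ring

/-- The quantity `(1 - s^q)(1 - κ s^q)` under the integral defining `arcsnPQ`. -/
noncomputable def snWeight (q κ s : ℝ) : ℝ := (1 - s ^ q) * (1 - κ * s ^ q)

theorem continuous_snWeight {q : ℝ} (hq : 1 < q) (κ : ℝ) : Continuous (snWeight q κ) := by
  have := Real.continuous_rpow_const (q := q) (by linarith)
  unfold snWeight
  fun_prop

theorem hasDerivAt_snWeight {q : ℝ} (hq : 1 < q) (κ s : ℝ) :
    HasDerivAt (snWeight q κ) (-(q * s ^ (q - 1) * (1 + κ - 2 * κ * s ^ q))) s := by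
  have h := Real.hasDerivAt_rpow_const (x := s) (p := q) (Or.inr hq.le)
  have h' : HasDerivAt (snWeight q κ) _ s := (h.const_sub 1).mul ((h.const_mul κ).const_sub 1)
  convert h' using 1
  ring

theorem snWeight_lower {q κ s : ℝ} (hq : 1 < q) (hκ : κ ∈ Ico (0:ℝ) 1) (hs : s ∈ Icc (0:ℝ) 1) :
    (1 - s) * (1 - κ) ≤ snWeight q κ s := by
  have h1 : s ^ q ≤ s := by
    simpa using Real.rpow_le_rpow_of_exponent_ge' hs.1 hs.2 zero_le_one hq.le
  have h0 := Real.rpow_nonneg hs.1 q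
  have h2 : κ * s ^ q ≤ κ := mul_le_of_le_one_right hκ.1 (h1.trans hs.2)
  exact mul_le_mul (by linarith) (by linarith) (by linarith [hκ.2]) (by linarith [hs.2])

theorem snWeight_nonneg {q κ s : ℝ} (hq : 1 < q) (hκ : κ ∈ Ico (0:ℝ) 1) (hs : s ∈ Icc (0:ℝ) 1) :
    0 ≤ snWeight q κ s :=
  (mul_nonneg (by linarith [hs.2]) (by linarith [hκ.2])).trans (snWeight_lower hq hκ hs)

theorem snWeight_pos {q κ s : ℝ} (hq : 1 < q) (hκ : κ ∈ Ico (0:ℝ) 1) (hs : s ∈ Ico (0:ℝ) 1) :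
    0 < snWeight q κ s :=
  (mul_pos (by linarith [hs.2]) (by linarith [hκ.2])).trans_le
    (snWeight_lower hq hκ (Ico_subset_Icc_self hs))

theorem snWeight_le_one {q κ s : ℝ} (hq : 1 < q) (hκ : κ ∈ Ico (0:ℝ) 1) (hs : s ∈ Icc (0:ℝ) 1) :
    snWeight q κ s ≤ 1 := by
  have h0 := Real.rpow_nonneg hs.1 q
  have h1 := Real.rpow_le_one hs.1 hs.2 (by linarith : (0:ℝ) ≤ q)
  have h2 : 0 ≤ κ * s ^ q := mul_nonneg hκ.1 h0
  have h3 : κ * s ^ q ≤ 1 := mul_le_one₀ hκ.2.le h0 h1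
  unfold snWeight
  nlinarith

theorem rpow_mem_Ico {q k : ℝ} (hq : 1 < q) (hk : k ∈ Ico (0:ℝ) 1) : k ^ q ∈ Ico (0:ℝ) 1 :=
  ⟨Real.rpow_nonneg hk.1 q, Real.rpow_lt_one hk.1 hk.2 (by linarith)⟩

theorem intervalIntegrable_snWeight {p q κ : ℝ} (hp : 1 < p) (hq : 1 < q)
    (hκ : κ ∈ Ico (0:ℝ) 1) :
    IntervalIntegrable (fun s => snWeight q κ s ^ (-(1 / p))) volume 0 1 := by
  have hp0 : 0 < p := by linarith
  have hp1 : 1 / p < 1 := by rw [div_lt_one hp0]; exact hp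
  have hp2 : 0 < 1 / p := by positivity
  have h1 : IntervalIntegrable (fun s : ℝ => (1 - s) ^ (-(1 / p)) * (1 - κ) ^ (-(1 / p)))
      volume 0 1 := by
    have := ((intervalIntegral.intervalIntegrable_rpow' (a := 0) (b := 1)
      (r := -(1 / p)) (by linarith)).comp_sub_left 1).symm
    simp only [sub_zero, sub_self] at this
    exact this.mul_const _
  refine h1.mono_fun' ?_ ?_
  · exact ((continuous_snWeight hq κ).measurable.pow_const _).aestronglyMeasurable
  · have hne : ∀ᵐ s : ℝ ∂(volume.restrict (uIoc (0:ℝ) 1)), s ≠ 1 :=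
      ae_restrict_of_ae (Measure.ae_ne volume 1)
    filter_upwards [hne, ae_restrict_mem measurableSet_uIoc] with s hs hs'
    rw [uIoc_of_le zero_le_one] at hs'
    have hs1 : s < 1 := lt_of_le_of_ne hs'.2 hs
    have hκ1 : 0 < 1 - κ := by linarith [hκ.2]
    rw [Real.norm_of_nonneg (Real.rpow_nonneg (snWeight_nonneg hq hκ ⟨hs'.1.le, hs'.2⟩) _),
      ← Real.mul_rpow (by linarith) hκ1.le]
    exact Real.rpow_le_rpow_of_nonpos (mul_pos (by linarith) hκ1)
      (snWeight_lower hq hκ ⟨hs'.1.le, hs'.2⟩) (by linarith)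

theorem arcsnPQ_eq_integral_snWeight (p q k σ : ℝ) :
    arcsnPQ p q k σ = ∫ s in (0:ℝ)..σ, snWeight q (k ^ q) s ^ (-(1 / p)) := rfl

theorem continuousOn_arcsnPQ {p q k : ℝ} (hp : 1 < p) (hq : 1 < q) (hk : k ∈ Ico (0:ℝ) 1) :
    ContinuousOn (arcsnPQ p q k) (Icc 0 1) := by
  have := intervalIntegral.continuousOn_primitive_interval' (a := (0:ℝ))
    (intervalIntegrable_snWeight hp hq (rpow_mem_Ico hq hk)) left_mem_uIcc
  rwa [uIcc_of_le zero_le_one] at this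

theorem sub_le_arcsnPQ_sub {p q k a b : ℝ} (hp : 1 < p) (hq : 1 < q) (hk : k ∈ Ico (0:ℝ) 1)
    (ha : 0 ≤ a) (hab : a ≤ b) (hb : b ≤ 1) :
    b - a ≤ arcsnPQ p q k b - arcsnPQ p q k a := by
  have hκ := rpow_mem_Ico hq hk
  have hI := intervalIntegrable_snWeight hp hq hκ
  have hIa : ∀ {x y : ℝ}, 0 ≤ x → x ≤ y → y ≤ 1 →
      IntervalIntegrable (fun s => snWeight q (k ^ q) s ^ (-(1 / p))) volume x y :=
    fun hx hxy hy => hI.mono_set (by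
      rw [uIcc_of_le hxy, uIcc_of_le zero_le_one]; exact Icc_subset_Icc hx hy)
  rw [arcsnPQ_eq_integral_snWeight, arcsnPQ_eq_integral_snWeight,
    intervalIntegral.integral_interval_sub_left (hIa le_rfl (ha.trans hab) hb)
      (hIa le_rfl ha (hab.trans hb))]
  have := intervalIntegral.integral_mono_on_of_le_Ioo (μ := volume) hab
    (intervalIntegrable_const (c := (1:ℝ))) (hIa ha hab hb) (fun x hx =>
      Real.one_le_rpow_of_pos_of_le_one_of_nonpos
        (snWeight_pos hq hκ ⟨ha.trans hx.1.le, hx.2.trans_le hb⟩)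
        (snWeight_le_one hq hκ ⟨ha.trans hx.1.le, hx.2.le.trans hb⟩)
        (neg_nonpos.2 (by positivity)))
  simpa using this

theorem hasDerivAt_arcsnPQ {p q k σ : ℝ} (hp : 1 < p) (hq : 1 < q) (hk : k ∈ Ico (0:ℝ) 1)
    (hσ : σ ∈ Ioo (0:ℝ) 1) :
    HasDerivAt (arcsnPQ p q k) (snWeight q (k ^ q) σ ^ (-(1 / p))) σ := by
  have hκ := rpow_mem_Ico hq hk
  refine intervalIntegral.integral_hasDerivAt_right
    (f := fun s => snWeight q (k ^ q) s ^ (-(1 / p))) (a := 0) (b := σ) ?_ ?_ ?_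
  · refine (intervalIntegrable_snWeight hp hq hκ).mono_set ?_
    rw [uIcc_of_le hσ.1.le, uIcc_of_le zero_le_one]
    exact Icc_subset_Icc le_rfl hσ.2.le
  · exact ((continuous_snWeight hq _).measurable.pow_const
      _).stronglyMeasurable.stronglyMeasurableAtFilter
  · exact (continuous_snWeight hq _).continuousAt.rpow_const
      (Or.inl (snWeight_pos hq hκ ⟨hσ.1.le, hσ.2⟩).ne')

theorem arcsnPQ_zero (p q k : ℝ) : arcsnPQ p q k 0 = 0 := intervalIntegral.integral_same

theorem Kpq_pos {p q k : ℝ} (hp : 1 < p) (hq : 1 < q) (hk : k ∈ Ico (0:ℝ) 1) :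
    0 < Kpq p q k := by
  have := sub_le_arcsnPQ_sub hp hq hk le_rfl zero_le_one le_rfl
  rw [arcsnPQ_zero] at this
  unfold Kpq
  linarith

theorem reflect_of_periodic {K : ℝ} {S : ℝ → ℝ} (hK : 0 < K)
    (hrefl : ∀ t ∈ Icc K (2 * K), S t = S (2 * K - t)) (hodd : ∀ t, S (-t) = -S t)
    (hper : ∀ t, S (t + 4 * K) = S t) (t : ℝ) : S (2 * K - t) = S t := by
  have h0 : ∀ t ∈ Icc 0 (2 * K), S (2 * K - t) = S t := by
    intro t ht
    rcases le_total K t with h | h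
    · exact (hrefl t ⟨h, ht.2⟩).symm
    · rw [hrefl (2 * K - t) ⟨by linarith, by linarith [ht.1]⟩]
      congr 1
      ring
  have h1 : ∀ t ∈ Ico (-(2 * K)) (2 * K), S (2 * K - t) = S t := by
    intro t ht
    rcases le_total 0 t with h | h
    · exact h0 t ⟨h, ht.2.le⟩
    · have h2 := h0 (-t) ⟨by linarith, by linarith [ht.1]⟩
      have h3 := hper (t - 2 * K)
      rw [show t - 2 * K + 4 * K = 2 * K - -t by ring, h2, hodd] at h3
      rw [show 2 * K - t = -(t - 2 * K) by ring, hodd, ← h3, neg_neg]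
  have hP : Function.Periodic (fun t => S (2 * K - t) - S t) (4 * K) := fun t => by
    have := hper (2 * K - (t + 4 * K))
    simp only [hper]
    rw [← this]
    ring_nf
  obtain ⟨y, hy, h⟩ := hP.exists_mem_Ico (by linarith) t (-(2 * K))
  have := h1 y ⟨hy.1, by linarith [hy.2]⟩
  linarith

theorem forall_of_forall_Icc_of_reflect {K : ℝ} {P : ℝ → Prop} (hK : 0 < K)
    (hneg : ∀ t, P t → P (-t)) (hrefl : ∀ t, P t → P (2 * K - t)) (h : ∀ t ∈ Icc 0 K, P t)
    (t : ℝ) : P t := by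
  have hP : Function.Periodic P (2 * K) := fun t => propext
    ⟨fun ht => by simpa using hneg _ (hrefl _ ht),
      fun ht => by simpa [add_comm] using hrefl _ (hneg _ ht)⟩
  obtain ⟨y, hy, e⟩ := hP.exists_mem_Ico₀ (by linarith) t
  rw [e]
  rcases le_total y K with hyK | hyK
  · exact h y ⟨hy.1, hyK⟩
  · simpa using hrefl _ (h (2 * K - y) ⟨by linarith [hy.2], by linarith⟩)

section InverseOfArcsn

variable {p q k : ℝ} {S : ℝ → ℝ}

theorem mem_and_arcsnPQ_apply (hp : 1 < p) (hq : 1 < q) (hk : k ∈ Ico (0:ℝ) 1)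
    (hinv : ∀ σ ∈ Icc (0:ℝ) 1, S (arcsnPQ p q k σ) = σ) {t : ℝ} (ht : t ∈ Icc 0 (Kpq p q k)) :
    S t ∈ Icc (0:ℝ) 1 ∧ arcsnPQ p q k (S t) = t := by
  have h := intermediate_value_Icc zero_le_one (continuousOn_arcsnPQ hp hq hk)
  rw [arcsnPQ_zero] at h
  obtain ⟨σ, hσ, rfl⟩ := h ht
  rw [hinv σ hσ]
  exact ⟨hσ, rfl⟩

theorem mem_Ioo_of_inverse (hp : 1 < p) (hq : 1 < q) (hk : k ∈ Ico (0:ℝ) 1)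
    (hinv : ∀ σ ∈ Icc (0:ℝ) 1, S (arcsnPQ p q k σ) = σ) {t : ℝ} (ht : t ∈ Ioo 0 (Kpq p q k)) :
    S t ∈ Ioo (0:ℝ) 1 := by
  obtain ⟨h, e⟩ := mem_and_arcsnPQ_apply hp hq hk hinv (Ioo_subset_Icc_self ht)
  refine ⟨lt_of_le_of_ne h.1 fun h0 => ?_, lt_of_le_of_ne h.2 fun h1 => ?_⟩
  · rw [← h0, arcsnPQ_zero] at e
    exact ht.1.ne e
  · rw [h1] at e
    exact ht.2.ne e.symm

theorem continuousOn_of_inverse (hp : 1 < p) (hq : 1 < q) (hk : k ∈ Ico (0:ℝ) 1)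
    (hinv : ∀ σ ∈ Icc (0:ℝ) 1, S (arcsnPQ p q k σ) = σ) :
    ContinuousOn S (Icc 0 (Kpq p q k)) := by
  have hL : LipschitzOnWith 1 S (Icc 0 (Kpq p q k)) := by
    refine LipschitzOnWith.of_dist_le_mul fun x hx y hy => ?_
    obtain ⟨hx1, hx2⟩ := mem_and_arcsnPQ_apply hp hq hk hinv hx
    obtain ⟨hy1, hy2⟩ := mem_and_arcsnPQ_apply hp hq hk hinv hy
    rw [NNReal.coe_one, one_mul, Real.dist_eq, Real.dist_eq]
    rcases le_total (S x) (S y) with h | h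
    · have := sub_le_arcsnPQ_sub hp hq hk hx1.1 h hy1.2
      rw [hx2, hy2] at this
      rw [abs_sub_comm, abs_sub_comm x, abs_of_nonneg (sub_nonneg.2 h)]
      exact this.trans (le_abs_self _)
    · have := sub_le_arcsnPQ_sub hp hq hk hy1.1 h hx1.2
      rw [hx2, hy2] at this
      rw [abs_of_nonneg (sub_nonneg.2 h)]
      exact this.trans (le_abs_self _)
  exact hL.continuousOn

theorem hasDerivAt_of_inverse (hp : 1 < p) (hq : 1 < q) (hk : k ∈ Ico (0:ℝ) 1)
    (hinv : ∀ σ ∈ Icc (0:ℝ) 1, S (arcsnPQ p q k σ) = σ) {t : ℝ} (ht : t ∈ Ioo 0 (Kpq p q k)) :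
    HasDerivAt S (snWeight q (k ^ q) (S t) ^ (1 / p)) t := by
  have hmem := mem_Ioo_of_inverse hp hq hk hinv ht
  have hpos := snWeight_pos hq (rpow_mem_Ico hq hk) ⟨hmem.1.le, hmem.2⟩
  have h := HasDerivAt.of_local_left_inverse
    ((continuousOn_of_inverse hp hq hk hinv).continuousAt (Icc_mem_nhds ht.1 ht.2))
    (hasDerivAt_arcsnPQ hp hq hk hmem) (Real.rpow_pos_of_pos hpos _).ne'
    (by
      filter_upwards [Ioo_mem_nhds ht.1 ht.2] with y hy
      exact (mem_and_arcsnPQ_apply hp hq hk hinv (Ioo_subset_Icc_self hy)).2)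
  rwa [Real.rpow_neg hpos.le, inv_inv] at h

theorem hasDerivAt_of_inverse_of_reflect (hp : 1 < p) (hq : 1 < q) (hk : k ∈ Ico (0:ℝ) 1)
    (hinv : ∀ σ ∈ Icc (0:ℝ) 1, S (arcsnPQ p q k σ) = σ) (hodd : ∀ t, S (-t) = -S t)
    (hrefl : ∀ t, S (2 * Kpq p q k - t) = S t) {t : ℝ} (ht : t ∈ Icc 0 (Kpq p q k)) :
    HasDerivAt S (snWeight q (k ^ q) (S t) ^ (1 / p)) t := by
  have hK := Kpq_pos hp hq hk
  have hS := continuousOn_of_inverse hp hq hk hinv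
  have hD : ContinuousOn (fun t => snWeight q (k ^ q) (S t) ^ (1 / p)) (Icc 0 (Kpq p q k)) :=
    ((continuous_snWeight hq _).comp_continuousOn hS).rpow_const
      fun _ _ => Or.inr (by positivity)
  have hdiff : DifferentiableOn ℝ S (Ioo 0 (Kpq p q k)) := fun x hx =>
    (hasDerivAt_of_inverse hp hq hk hinv hx).differentiableAt.differentiableWithinAt
  rcases ht.1.eq_or_lt with rfl | h0
  · refine hasDerivAt_of_Ici_of_reflect (ε := -1) (by simpa using hodd) (by ring) (by ring) ?_
    refine hasDerivWithinAt_Ici_of_tendsto_deriv hdiff ((hS 0 ht).mono Ioo_subset_Icc_self)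
      (Ioo_mem_nhdsGT hK) ?_
    have := (hD 0 ht).mono_left (nhdsWithin_mono 0 Ioo_subset_Icc_self)
    rw [nhdsWithin_Ioo_eq_nhdsGT hK] at this
    refine this.congr' ?_
    filter_upwards [Ioo_mem_nhdsGT hK] with x hx
    exact (hasDerivAt_of_inverse hp hq hk hinv hx).deriv.symm
  rcases ht.2.eq_or_lt with rfl | h1
  · have hone : S (Kpq p q k) = 1 := hinv 1 ⟨zero_le_one, le_rfl⟩
    have hzero : snWeight q (k ^ q) (S (Kpq p q k)) ^ (1 / p) = 0 := by
      rw [hone, snWeight, Real.one_rpow, sub_self, zero_mul, Real.zero_rpow (by positivity)]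
    refine hasDerivAt_of_Iic_of_reflect (ε := 1) (by simpa using hrefl) (by rw [hzero]; simp)
      (by ring) ?_
    refine hasDerivWithinAt_Iic_of_tendsto_deriv hdiff ((hS _ ht).mono Ioo_subset_Icc_self)
      (Ioo_mem_nhdsLT hK) ?_
    have := (hD _ ht).mono_left (nhdsWithin_mono _ Ioo_subset_Icc_self)
    rw [nhdsWithin_Ioo_eq_nhdsLT hK] at this
    refine this.congr' ?_
    filter_upwards [Ioo_mem_nhdsLT hK] with x hx
    exact (hasDerivAt_of_inverse hp hq hk hinv hx).deriv.symm
  · exact hasDerivAt_of_inverse hp hq hk hinv ⟨h0, h1⟩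

theorem phi_rpow_eq {x : ℝ} (hp : 1 < p) (hx : 0 ≤ x) :
    phi p (x ^ (1 / p)) = x ^ ((p - 1) / p) := by
  rw [phi_of_nonneg hp.ne' (Real.rpow_nonneg hx _), ← Real.rpow_mul hx]
  congr 1
  ring

theorem deriv_neg_of_odd (hodd : ∀ t, S (-t) = -S t) (x : ℝ) : deriv S (-x) = deriv S x := by
  have h := deriv_comp_neg S x
  simp only [hodd, deriv.fun_neg, neg_inj] at h
  exact h.symm

theorem deriv_const_sub_of_reflect {c : ℝ} (hrefl : ∀ t, S (c - t) = S t) (x : ℝ) :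
    deriv S (c - x) = -deriv S x := by
  have h := deriv_comp_const_sub (f := S) c x
  simp only [hrefl] at h
  rw [h, neg_neg]

theorem hasDerivAt_phi_deriv_of_inverse (hp : 1 < p) (hq : 1 < q) (hk : k ∈ Ico (0:ℝ) 1)
    (hinv : ∀ σ ∈ Icc (0:ℝ) 1, S (arcsnPQ p q k σ) = σ) (hodd : ∀ t, S (-t) = -S t)
    (hrefl : ∀ t, S (2 * Kpq p q k - t) = S t) {t : ℝ} (ht : t ∈ Icc 0 (Kpq p q k)) :
    HasDerivAt (fun s => phi p (deriv S s))
      (-((p - 1) / p * q * phi q (S t) * (1 + k ^ q - 2 * k ^ q * |S t| ^ q))) t := by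
  have hK := Kpq_pos hp hq hk
  have hκ := rpow_mem_Ico hq hk
  have hp0 : 0 < p := by linarith
  have hS := continuousOn_of_inverse hp hq hk hinv
  have hmem : ∀ x ∈ Icc 0 (Kpq p q k), S x ∈ Icc (0:ℝ) 1 := fun x hx =>
    (mem_and_arcsnPQ_apply hp hq hk hinv hx).1
  set H : ℝ → ℝ := fun x =>
    (p - 1) / p * -(q * S x ^ (q - 1) * (1 + k ^ q - 2 * k ^ q * S x ^ q)) with hH
  have hHeq : ∀ x ∈ Icc 0 (Kpq p q k),
      -((p - 1) / p * q * phi q (S x) * (1 + k ^ q - 2 * k ^ q * |S x| ^ q)) = H x := by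
    intro x hx
    rw [hH, phi_of_nonneg hq.ne' (hmem x hx).1, abs_of_nonneg (hmem x hx).1]
    ring
  rw [hHeq t ht]
  have hW : ∀ x ∈ Icc 0 (Kpq p q k),
      snWeight q (k ^ q) (S x) ^ ((p - 1) / p) = phi p (deriv S x) := by
    intro x hx
    rw [(hasDerivAt_of_inverse_of_reflect hp hq hk hinv hodd hrefl hx).deriv,
      phi_rpow_eq hp (snWeight_nonneg hq hκ (hmem x hx))]
  have hWd : ∀ x ∈ Ioo 0 (Kpq p q k), HasDerivAt (fun s => phi p (deriv S s)) (H x) x := by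
    intro x hx
    have hx1 := mem_Ioo_of_inverse hp hq hk hinv hx
    have hpos := snWeight_pos hq hκ ⟨hx1.1.le, hx1.2⟩
    have h := (((hasDerivAt_snWeight hq (k ^ q) (S x)).comp x
      (hasDerivAt_of_inverse hp hq hk hinv hx))).rpow_const (p := (p - 1) / p) (Or.inl hpos.ne')
    have he : snWeight q (k ^ q) (S x) ^ (1 / p) *
        snWeight q (k ^ q) (S x) ^ ((p - 1) / p - 1) = 1 := by
      rw [← Real.rpow_add hpos, show 1 / p + ((p - 1) / p - 1) = 0 by field_simp; ring,
        Real.rpow_zero]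
    have h' : HasDerivAt (fun s => snWeight q (k ^ q) (S s) ^ ((p - 1) / p)) (H x) x := by
      convert! h using 1
      rw [hH]
      simp only [Function.comp]
      linear_combination ((p - 1) / p * (q * S x ^ (q - 1) *
        (1 + k ^ q - 2 * k ^ q * S x ^ q))) * he
    refine h'.congr_of_eventuallyEq ?_
    filter_upwards [Ioo_mem_nhds hx.1 hx.2] with y hy
    exact (hW y (Ioo_subset_Icc_self hy)).symm
  have hWc : ContinuousOn (fun s => phi p (deriv S s)) (Icc 0 (Kpq p q k)) := by
    refine ContinuousOn.congr (f := fun x => snWeight q (k ^ q) (S x) ^ ((p - 1) / p)) ?_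
      fun x hx => (hW x hx).symm
    exact ((continuous_snWeight hq _).comp_continuousOn hS).rpow_const
      fun _ _ => Or.inr (div_nonneg (by linarith) hp0.le)
  have hHc : ContinuousOn H (Icc 0 (Kpq p q k)) := by
    have h1 : ContinuousOn (fun x => S x ^ (q - 1)) (Icc 0 (Kpq p q k)) :=
      hS.rpow_const fun _ _ => Or.inr (by linarith)
    have h2 : ContinuousOn (fun x => S x ^ q) (Icc 0 (Kpq p q k)) :=
      hS.rpow_const fun _ _ => Or.inr (by linarith)
    rw [hH]
    fun_prop
  have hdiff : DifferentiableOn ℝ (fun s => phi p (deriv S s)) (Ioo 0 (Kpq p q k)) :=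
    fun x hx => (hWd x hx).differentiableAt.differentiableWithinAt
  rcases ht.1.eq_or_lt with rfl | h0
  · have hzero : H 0 = 0 := by
      have hS0 : S 0 = 0 := by simpa [arcsnPQ_zero] using hinv 0 ⟨le_rfl, zero_le_one⟩
      rw [hH]
      simp [hS0, Real.zero_rpow (sub_ne_zero.2 hq.ne')]
    refine hasDerivAt_of_Ici_of_reflect (ε := 1) (fun x => ?_) (by simp [hzero]) (by ring) ?_
    · simp [deriv_neg_of_odd hodd]
    refine hasDerivWithinAt_Ici_of_tendsto_deriv hdiff ((hWc 0 ht).mono Ioo_subset_Icc_self)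
      (Ioo_mem_nhdsGT hK) ?_
    have := (hHc 0 ht).mono_left (nhdsWithin_mono 0 Ioo_subset_Icc_self)
    rw [nhdsWithin_Ioo_eq_nhdsGT hK] at this
    refine this.congr' ?_
    filter_upwards [Ioo_mem_nhdsGT hK] with x hx
    exact (hWd x hx).deriv.symm
  rcases ht.2.eq_or_lt with rfl | h1
  · refine hasDerivAt_of_Iic_of_reflect (ε := -1) (fun x => ?_) (by ring) (by ring) ?_
    · rw [deriv_const_sub_of_reflect hrefl, phi_neg, neg_one_mul]
    refine hasDerivWithinAt_Iic_of_tendsto_deriv hdiff ((hWc _ ht).mono Ioo_subset_Icc_self)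
      (Ioo_mem_nhdsLT hK) ?_
    have := (hHc _ ht).mono_left (nhdsWithin_mono _ Ioo_subset_Icc_self)
    rw [nhdsWithin_Ioo_eq_nhdsLT hK] at this
    refine this.congr' ?_
    filter_upwards [Ioo_mem_nhdsLT hK] with x hx
    exact (hWd x hx).deriv.symm
  · exact hWd t ⟨h0, h1⟩

theorem differentiable_and_hasDerivAt_phi_deriv (hp : 1 < p) (hq : 1 < q)
    (hk : k ∈ Ico (0:ℝ) 1) (hinv : ∀ σ ∈ Icc (0:ℝ) 1, S (arcsnPQ p q k σ) = σ)
    (hodd : ∀ t, S (-t) = -S t) (hrefl : ∀ t, S (2 * Kpq p q k - t) = S t) (t : ℝ) :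
    DifferentiableAt ℝ S t ∧ HasDerivAt (fun s => phi p (deriv S s))
      (-((p - 1) / p * q * phi q (S t) * (1 + k ^ q - 2 * k ^ q * |S t| ^ q))) t := by
  refine forall_of_forall_Icc_of_reflect (P := fun t => DifferentiableAt ℝ S t ∧
    HasDerivAt (fun s => phi p (deriv S s))
      (-((p - 1) / p * q * phi q (S t) * (1 + k ^ q - 2 * k ^ q * |S t| ^ q))) t)
    (Kpq_pos hp hq hk) ?_ ?_ ?_ t
  · rintro t ⟨h1, h2⟩
    rw [← neg_neg t] at h1 h2
    constructor
    · have := (h1.comp (-t) differentiable_neg.differentiableAt).neg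
      refine this.congr_of_eventuallyEq (Eventually.of_forall fun x => ?_)
      simp [hodd]
    · have := h2.comp (-t) (hasDerivAt_neg (-t))
      simp only [neg_neg, Function.comp_def, deriv_neg_of_odd hodd] at this
      convert! this using 1
      rw [hodd, phi_neg, abs_neg]
      ring
  · rintro t ⟨h1, h2⟩
    have ht : t = 2 * Kpq p q k - (2 * Kpq p q k - t) := by ring
    have hr : HasDerivAt (fun x => 2 * Kpq p q k - x) (-1) (2 * Kpq p q k - t) := by
      simpa using (hasDerivAt_id (2 * Kpq p q k - t)).const_sub (2 * Kpq p q k)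
    rw [hrefl]
    constructor
    · rw [ht] at h1
      have := h1.comp (2 * Kpq p q k - t) hr.differentiableAt
      refine this.congr_of_eventuallyEq (Eventually.of_forall fun x => ?_)
      simp [hrefl]
    · have h3 := (HasDerivAt.comp (2 * Kpq p q k - t) (ht ▸ h2) hr).neg
      have hfun : (fun s => phi p (deriv S s)) =
          fun s => -phi p (deriv S (2 * Kpq p q k - s)) := by
        funext s
        rw [deriv_const_sub_of_reflect hrefl, phi_neg, neg_neg]
      rw [hfun]
      convert! h3 using 1
      rw [← ht]
      ring
  · exact fun t ht => ⟨(hasDerivAt_of_inverse_of_reflect hp hq hk hinv hodd hrefl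
      ht).differentiableAt, hasDerivAt_phi_deriv_of_inverse hp hq hk hinv hodd hrefl ht⟩

theorem deriv_zero_of_inverse (hp : 1 < p) (hq : 1 < q) (hk : k ∈ Ico (0:ℝ) 1)
    (hinv : ∀ σ ∈ Icc (0:ℝ) 1, S (arcsnPQ p q k σ) = σ) (hodd : ∀ t, S (-t) = -S t)
    (hrefl : ∀ t, S (2 * Kpq p q k - t) = S t) : deriv S 0 = 1 := by
  have hS0 : S 0 = 0 := by simpa [arcsnPQ_zero] using hinv 0 ⟨le_rfl, zero_le_one⟩
  rw [(hasDerivAt_of_inverse_of_reflect hp hq hk hinv hodd hrefl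
    ⟨le_rfl, (Kpq_pos hp hq hk).le⟩).deriv, hS0, snWeight,
    Real.zero_rpow (by linarith : q ≠ 0)]
  simp

end InverseOfArcsn

theorem stmt12 (p q lam α : ℝ) (hp : 1 < p) (hq : 1 < q) (hlam : 0 < lam) (hα : 0 < α)
    (hsmall : α ^ p < lam * (p / (p - 1)) / (2 * q))
    (sn : ℝ → ℝ → ℝ)
    (hsn_inv : ∀ k ∈ Ico (0:ℝ) 1, ∀ σ ∈ Icc (0:ℝ) 1, sn k (arcsnPQ p q k σ) = σ)
    (hsn_refl : ∀ k ∈ Ico (0:ℝ) 1, ∀ t ∈ Icc (Kpq p q k) (2 * Kpq p q k),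
      sn k t = sn k (2 * Kpq p q k - t))
    (hsn_odd : ∀ k ∈ Ico (0:ℝ) 1, ∀ t : ℝ, sn k (-t) = - sn k t)
    (hsn_per : ∀ k ∈ Ico (0:ℝ) 1, ∀ t : ℝ, sn k (t + 4 * Kpq p q k) = sn k t) :
    let pstar := p / (p - 1)
    let R := (q / (lam * pstar)) ^ (1 / q) * α ^ (p / q) *
      (1 / 2 + 1 / 2 * Real.sqrt (1 - 2 * q * α ^ p / (lam * pstar))) ^ (-(1 / q))
    let k := (R ^ q / (2 - R ^ q)) ^ (1 / q)
    let F := fun s : ℝ => s ^ q - s ^ (2 * q) / 2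
    let u := fun t : ℝ => R * sn k ((lam * pstar / q) ^ (1 / p) * (F R ^ (1 / p) / R) * t)
    R ∈ Ioo (0:ℝ) 1 ∧ u 0 = 0 ∧
    ∃ u' : ℝ → ℝ, (∀ t : ℝ, HasDerivAt u (u' t) t) ∧ u' 0 = α ∧
      ∀ t : ℝ, HasDerivAt (fun s => phi p (u' s))
        (-(lam * phi q (u t) * (1 - |u t| ^ q))) t := by
  intro pstar R k F u
  have hp0 : 0 < p := by linarith
  have hq0 : 0 < q := by linarith
  have hP : 0 < pstar := div_pos hp0 (by linarith)
  have hPp : (p - 1) / p * pstar = 1 := by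
    have : p - 1 ≠ 0 := by linarith
    simp only [pstar]
    field_simp
  have hαp : 0 < α ^ p := Real.rpow_pos_of_pos hα p
  set r := Real.sqrt (1 - 2 * q * α ^ p / (lam * pstar)) with hr
  have hsmall' : 2 * q * α ^ p / (lam * pstar) < 1 := by
    rw [div_lt_one (by positivity)]
    have := (lt_div_iff₀ (by positivity)).1 hsmall
    linarith
  have hpos : 0 < 2 * q * α ^ p / (lam * pstar) := by positivity
  have hr2 : r ^ 2 = 1 - 2 * q * α ^ p / (lam * pstar) := Real.sq_sqrt (by linarith)
  have hr0 : 0 < r := Real.sqrt_pos.2 (by linarith)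
  have hr1 : r < 1 := by nlinarith
  have hR0 : 0 < R := by positivity
  have hRq : R ^ q = 1 - r := by
    have h1 : R ^ q = q / (lam * pstar) * α ^ p * (1 / 2 + 1 / 2 * r)⁻¹ := by
      simp only [R]
      rw [Real.mul_rpow (by positivity) (by positivity),
        Real.mul_rpow (by positivity) (by positivity), ← Real.rpow_mul (by positivity),
        ← Real.rpow_mul hα.le, ← Real.rpow_mul (by positivity), neg_mul,
        one_div_mul_cancel hq0.ne', div_mul_cancel₀ _ hq0.ne', Real.rpow_one,
        Real.rpow_neg_one]
    rw [h1, mul_inv_eq_iff_eq_mul₀ (by positivity)]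
    linear_combination (1 / 2) * hr2
  have hR1 : R < 1 := by
    by_contra! h
    have := Real.one_le_rpow h hq0.le
    linarith
  have hkq : k ^ q = (1 - r) / (1 + r) := by
    simp only [k]
    rw [hRq, show 2 - (1 - r) = 1 + r by ring,
      ← Real.rpow_mul (div_nonneg (by linarith) (by linarith)), one_div_mul_cancel hq0.ne',
      Real.rpow_one]
  have hk0 : 0 ≤ k := by
    refine Real.rpow_nonneg ?_ _
    rw [hRq]
    exact div_nonneg (by linarith) (by linarith)
  have hk : k ∈ Ico (0:ℝ) 1 := by
    refine ⟨hk0, ?_⟩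
    by_contra! h
    have := Real.one_le_rpow h hq0.le
    rw [hkq, le_div_iff₀ (by linarith)] at this
    linarith
  have hFR : F R = q * α ^ p / (lam * pstar) := by
    simp only [F]
    rw [mul_comm 2 q, Real.rpow_mul hR0.le, Real.rpow_two, hRq]
    linear_combination (-1 / 2) * hr2
  have hc : (lam * pstar / q) ^ (1 / p) * (F R ^ (1 / p) / R) = α / R := by
    rw [← mul_div_assoc, hFR, ← Real.mul_rpow (by positivity) (by positivity),
      show lam * pstar / q * (q * α ^ p / (lam * pstar)) = α ^ p by field_simp,
      ← Real.rpow_mul hα.le, mul_one_div_cancel hp0.ne', Real.rpow_one]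
  have hu : u = fun t => R * sn k (α / R * t) := by
    funext t
    simp only [u, hc]
  have hinv := hsn_inv k hk
  have hodd := hsn_odd k hk
  have hrefl := reflect_of_periodic (Kpq_pos hp hq hk) (hsn_refl k hk) hodd (hsn_per k hk)
  have hlin : ∀ t : ℝ, HasDerivAt (fun t => α / R * t) (α / R) t := fun t => by
    simpa using (hasDerivAt_id t).const_mul (α / R)
  refine ⟨⟨hR0, hR1⟩, ?_, fun t => α * deriv (sn k) (α / R * t), fun t => ?_, ?_, fun t => ?_⟩
  · have := hinv 0 ⟨le_rfl, zero_le_one⟩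
    rw [arcsnPQ_zero] at this
    simp [hu, this]
  · obtain ⟨h, -⟩ := differentiable_and_hasDerivAt_phi_deriv hp hq hk hinv hodd hrefl (α / R * t)
    rw [hu]
    convert! (h.hasDerivAt.comp t (hlin t)).const_mul R using 1
    field_simp
  · simp [deriv_zero_of_inverse hp hq hk hinv hodd hrefl]
  · obtain ⟨-, h⟩ := differentiable_and_hasDerivAt_phi_deriv hp hq hk hinv hodd hrefl (α / R * t)
    simp only [phi_mul hα, hu]
    convert! (h.comp t (hlin t)).const_mul (α ^ (p - 1)) using 1
    have hRq1 : R ^ (q - 1) = (1 - r) / R := by rw [Real.rpow_sub_one hR0.ne', hRq]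
    have hα1 : α ^ (p - 1) * α = α ^ p := by
      rw [← Real.rpow_add_one hα.ne', sub_add_cancel]
    have hαr : q * α ^ p = lam * pstar * (1 - r ^ 2) / 2 := by
      rw [hr2]
      field_simp
      ring
    rw [phi_mul hR0, abs_mul, abs_of_pos hR0, Real.mul_rpow hR0.le (abs_nonneg _), hRq, hRq1, hkq]
    set y := |sn k (α / R * t)| ^ q
    set z := phi q (sn k (α / R * t))
    have hy : 1 + (1 - r) / (1 + r) - 2 * ((1 - r) / (1 + r)) * y =
        2 * (1 - (1 - r) * y) / (1 + r) := by
      field_simp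
      ring
    rw [hy]
    calc -(lam * ((1 - r) / R * z) * (1 - (1 - r) * y))
        = -((p - 1) / p * pstar) * (lam * (1 - r) / R * z * (1 - (1 - r) * y)) := by
          rw [hPp]
          ring
      _ = -((p - 1) / p) * (q * α ^ p) * (z * (2 * (1 - (1 - r) * y) / (1 + r)) / R) := by
          rw [hαr]
          have : 1 + r ≠ 0 := by positivity
          field_simp
          ring
      _ = _ := by
          rw [← hα1]
          ring
end

section
/- Let 1 < p ≤ 2, q > 1, T > 0 and λ > 0. Then every nontrivial classical solution u of (φ_p(u'))' + λ·φ_q(u)·(1−|u|^q) = 0 on (0,T) with u(0) = u(T) = 0 and |u(t)| ≤ 1 on [0,T] satisfies |u(t)| < 1 for all t ∈ [0,T]; that is, there is no such solution attaining the values ±1. -/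
open Real Set Filter MeasureTheory

lemma abs_phi (m s : ℝ) (hs : s ≠ 0) : |phi m s| = |s| ^ (m - 2) * |s| := by
  rw [phi, if_neg hs, abs_mul, abs_of_nonneg (by positivity)]

lemma abs_phi_le_one {q s : ℝ} (hq : 1 < q) (hs : |s| ≤ 1) : |phi q s| ≤ 1 := by
  by_cases h : s = 0
  · simp [phi, h]
  · rw [abs_phi q s h, ← rpow_add_one (by positivity)]
    exact rpow_le_one (abs_nonneg _) hs (by linarith)

/-- The inverse of `φ_p` is Lipschitz on bounded sets when `p ≤ 2`. -/
lemma abs_le_mul_abs_phi {p s B : ℝ} (hp : p ≤ 2) (hs : |s| ≤ B) :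
    |s| ≤ B ^ (2 - p) * |phi p s| := by
  by_cases h : s = 0
  · simp [phi, h]
  · have h0 : 0 < |s| := abs_pos.mpr h
    calc |s| = |s| ^ (2 - p) * (|s| ^ (p - 2) * |s|) := by
          rw [← mul_assoc, ← rpow_add h0]
          simp
      _ ≤ B ^ (2 - p) * (|s| ^ (p - 2) * |s|) := by
          gcongr
      _ = B ^ (2 - p) * |phi p s| := by rw [abs_phi p s h]

lemma one_sub_abs_rpow_le {q s e : ℝ} (hq : 1 < q) (he : |e| = 1) :
    1 - |s| ^ q ≤ q * |e - s| := by
  have h := one_add_mul_self_le_rpow_one_add (s := |s| - 1)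
    (by linarith [abs_nonneg s]) hq.le
  rw [show 1 + (|s| - 1) = |s| by ring] at h
  have h2 := abs_sub_abs_le_abs_sub e s
  rw [he] at h2
  nlinarith

lemma abs_reaction_le {q lam s e : ℝ} (hq : 1 < q) (hlam : 0 < lam) (he : |e| = 1)
    (hs : |s| ≤ 1) : |-(lam * phi q s * (1 - |s| ^ q))| ≤ lam * q * |e - s| := by
  have h1 := abs_phi_le_one hq hs
  have h2 := one_sub_abs_rpow_le (s := s) hq he
  have h3 : 0 ≤ 1 - |s| ^ q :=
    sub_nonneg.mpr (rpow_le_one (abs_nonneg _) hs (by linarith))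
  rw [abs_neg, abs_mul, abs_mul, abs_of_pos hlam, abs_of_nonneg h3, mul_assoc, mul_assoc]
  refine mul_le_mul_of_nonneg_left ?_ hlam.le
  calc |phi q s| * (1 - |s| ^ q) ≤ 1 * (1 - |s| ^ q) := by gcongr
    _ ≤ q * |e - s| := by rwa [one_mul]

theorem stmt14 (p q T lam : ℝ) (hp1 : 1 < p) (hp2 : p ≤ 2) (hq : 1 < q)
    (hT : 0 < T) (hlam : 0 < lam)
    (u : ℝ → ℝ) (hu : IsSolP p q T lam u)
    (hnt : ¬ ∀ t ∈ Icc (0:ℝ) T, u t = 0)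
    (hb : ∀ t ∈ Icc (0:ℝ) T, |u t| ≤ 1) :
    ∀ t ∈ Icc (0:ℝ) T, |u t| < 1 := by
  obtain ⟨u', hu1, hu2, hu3, h0, hTe⟩ := hu
  intro t₀ ht₀
  refine lt_of_le_of_ne (hb t₀ ht₀) fun he => ?_
  have ht0 : 0 < t₀ := ht₀.1.lt_of_ne fun h => by simp [← h, h0] at he
  have htT : t₀ < T := ht₀.2.lt_of_ne fun h => by simp [h, hTe] at he
  have hmem : Icc 0 T ∈ nhds t₀ := Icc_mem_nhds ht0 htT
  have hcrit : u' t₀ = 0 := by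
    have hmax : IsLocalMax (fun t => u t ^ 2) t₀ := by
      filter_upwards [hmem] with t ht
      exact sq_le_sq.mpr (he ▸ hb t ht)
    have hd := hmax.hasDerivAt_eq_zero (((hu1 t₀ ht₀).hasDerivAt hmem).pow 2)
    have hne : u t₀ ≠ 0 := fun h => by simp [h] at he
    simpa [hne] using hd
  obtain ⟨B, hB⟩ := isCompact_Icc.exists_bound_of_continuousOn hu2
  set K := max (B ^ (2 - p)) (lam * q)
  have hsub : ∀ {b t}, b < T → t ∈ Icc t₀ b → t ∈ Ioo 0 T := fun hbT ht =>
    ⟨ht0.trans_le ht.1, ht.2.trans_lt hbT⟩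
  have hder : ∀ t ∈ Ioo 0 T, HasDerivAt (fun s => (u t₀ - u s, phi p (u' s)))
      (-u' t, -(lam * phi q (u t) * (1 - |u t| ^ q))) t := fun t ht =>
    (((hu1 t (Ioo_subset_Icc_self ht)).hasDerivAt (Icc_mem_nhds ht.1 ht.2)).const_sub _).prodMk
      ((hu3 t ht).hasDerivAt (Ioo_mem_nhds ht.1 ht.2))
  have hconst : ∀ t ∈ Ico t₀ T, u t = u t₀ := by
    intro b hbT
    have hg := norm_le_gronwallBound_of_norm_deriv_right_le (δ := 0) (ε := 0) (K := K)
      (a := t₀) (b := b)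
      (fun t ht => (hder t (hsub hbT.2 ht)).continuousAt.continuousWithinAt)
      (fun t ht => (hder t (hsub hbT.2 (Ico_subset_Icc_self ht))).hasDerivWithinAt)
      (by simp [hcrit, phi])
      (fun t ht => by
        have hm := Ioo_subset_Icc_self (hsub hbT.2 (Ico_subset_Icc_self ht))
        rw [add_zero, Prod.norm_def, Prod.norm_def]
        simp only [Real.norm_eq_abs, abs_neg (u' t)]
        have hK : 0 ≤ K := le_trans (by positivity) (le_max_right _ _)
        refine max_le ?_ ?_
        · calc |u' t| ≤ B ^ (2 - p) * |phi p (u' t)| := abs_le_mul_abs_phi hp2 (hB t hm)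
            _ ≤ _ := mul_le_mul (le_max_left _ _) (le_max_right _ _) (abs_nonneg _) hK
        · calc _ ≤ lam * q * |u t₀ - u t| := abs_reaction_le hq hlam he (hb t hm)
            _ ≤ _ := mul_le_mul (le_max_right _ _) (le_max_left _ _) (abs_nonneg _) hK)
      b ⟨hbT.1, le_rfl⟩
    rw [gronwallBound_ε0_δ0, norm_le_zero_iff] at hg
    exact (sub_eq_zero.mp (congrArg Prod.fst hg)).symm
  have hcl : T ∈ closure (Ico t₀ T) := by
    rw [closure_Ico htT.ne]
    exact right_mem_Icc.mpr htT.le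
  have hlim : Tendsto u (nhdsWithin T (Ico t₀ T)) (nhds (u T)) :=
    ((hu1 T (right_mem_Icc.mpr hT.le)).continuousWithinAt).mono
      fun t ht => ⟨ht0.le.trans ht.1, ht.2.le⟩
  have : (nhdsWithin T (Ico t₀ T)).NeBot := mem_closure_iff_nhdsWithin_neBot.mp hcl
  have heq : u T = u t₀ := tendsto_nhds_unique hlim
    (tendsto_const_nhds.congr' (by
      filter_upwards [self_mem_nhdsWithin] with t ht
      exact (hconst t ht).symm))
  simp [← heq, hTe] at he
end
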